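/- arXiv:2111.05996 — 5 statements merged into one kernel-verified Lean document; each statement's English description precedes it below -/
import Mathlib

section
/- Let n = 2^k + r with k ≥ 1 and 0 < r < 2^k, and let ρ₁ be the 2-adic valuation of r (the position of the least significant nonzero bit of r). Then 2·δ(n) = δ(n−1) + δ(n+1) + 2 − 2·ρ₁; equivalently, δ(n) = (1/2)·[δ(n−1) + δ(n+1)] + 1 − ρ₁. -/
/-- Number of D-nodes in the divide-and-conquer tree on `n` leaves:
`δ(1) = 0`, `δ(2m) = 2·δ(m)`, `δ(2m+1) = δ(m) + δ(m+1) + 1`. -/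
def delta : ℕ → ℕ
  | 0 => 0
  | 1 => 0
  | n + 2 =>
    if (n + 2) % 2 = 0 then 2 * delta ((n + 2) / 2)
    else delta ((n + 2) / 2) + delta ((n + 2) / 2 + 1) + 1
decreasing_by all_goals (simp_wf; omega)

theorem delta_two_mul (m : ℕ) : delta (2 * m) = 2 * delta m := by
  rcases m with _ | m
  · simp [delta]
  · rw [show 2 * (m + 1) = 2 * m + 2 by ring, delta]
    rw [if_pos (by omega), show (2 * m + 2) / 2 = m + 1 by omega]

theorem delta_two_mul_add_one {m : ℕ} (hm : 1 ≤ m) :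
    delta (2 * m + 1) = delta m + delta (m + 1) + 1 := by
  obtain ⟨m, rfl⟩ := Nat.exists_eq_add_of_le' hm
  rw [show 2 * (m + 1) + 1 = (2 * m + 1) + 2 by ring, delta]
  rw [if_neg (by omega), show (2 * m + 1 + 2) / 2 = m + 1 by omega]

theorem delta_pred_succ (k r : ℕ) (hk : 1 ≤ k) (hr0 : 0 < r) (hr : r < 2 ^ k) :
    2 * (delta (2 ^ k + r) : ℤ) =
      (delta (2 ^ k + r - 1) : ℤ) + (delta (2 ^ k + r + 1) : ℤ) + 2
        - 2 * (padicValNat 2 r : ℤ) := by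
  induction k generalizing r with
  | zero => omega
  | succ k ih =>
    have hpow : 2 ^ (k + 1) = 2 * 2 ^ k := pow_succ' 2 k
    have hpos : 0 < 2 ^ k := by positivity
    rcases Nat.even_or_odd' r with ⟨s, rfl | rfl⟩
    · have hs : s ≠ 0 := by omega
      have hk' : 1 ≤ k := by
        by_contra h
        obtain rfl : k = 0 := by omega
        omega
      have hval : padicValNat 2 (2 * s) = 1 + padicValNat 2 s := by
        rw [padicValNat.mul two_ne_zero hs, padicValNat_self]
      have h := ih s hk' (by omega) (by omega)
      obtain ⟨m, hm⟩ : ∃ m, 2 ^ k + s = m + 1 := ⟨2 ^ k + s - 1, by omega⟩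
      rw [hm, Nat.add_sub_cancel] at h
      rw [show 2 ^ (k + 1) + 2 * s = 2 * (m + 1) by omega,
        show 2 * (m + 1) - 1 = 2 * m + 1 by omega, delta_two_mul,
        delta_two_mul_add_one (m := m) (by omega),
        delta_two_mul_add_one (m := m + 1) (by omega), hval]
      omega
    · have hval : padicValNat 2 (2 * s + 1) = 0 :=
        padicValNat.eq_zero_of_not_dvd (by omega)
      rw [show 2 ^ (k + 1) + (2 * s + 1) = 2 * (2 ^ k + s) + 1 by omega,
        Nat.add_sub_cancel,
        show 2 * (2 ^ k + s) + 1 + 1 = 2 * (2 ^ k + s + 1) by ring,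
        delta_two_mul_add_one (by omega), delta_two_mul, delta_two_mul, hval]
      push_cast
      ring
end

section
/- Let n = 2^k + r with r odd and 0 < r < 2^k, and let i be an integer with 0 < i < k. Then λ_i(n) − λ_i(n−1) = 1 if bit i of the binary expansion of n is 0, and λ_i(n) − λ_i(n−1) = −1 if bit i of the binary expansion of n is 1. -/
/-- `λ_i(n) = n mod 2^i` if bit `i` of `n` is `0`, and `2^i - (n mod 2^i)` if bit `i` is `1`. -/
def lam (n i : ℕ) : ℕ := if n.testBit i then 2 ^ i - n % 2 ^ i else n % 2 ^ i

theorem lam_two_mul_succ (m j : ℕ) : lam (2 * m) (j + 1) = 2 * lam m j := by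
  have hm : 2 * m % 2 ^ (j + 1) = 2 * (m % 2 ^ j) := by
    rw [pow_succ', Nat.mul_mod_mul_left]
  have hb : (2 * m).testBit (j + 1) = m.testBit j := by
    rw [Nat.testBit_succ, Nat.mul_div_cancel_left m two_pos]
  unfold lam
  rw [hm, hb, pow_succ']
  split_ifs <;> omega

theorem lam_two_mul_add_one_succ (m j : ℕ) :
    (lam (2 * m + 1) (j + 1) : ℤ) = 2 * lam m j + if m.testBit j then -1 else 1 := by
  have hlt : m % 2 ^ j < 2 ^ j := Nat.mod_lt _ (by positivity)
  have hm : (2 * m + 1) % 2 ^ (j + 1) = 2 * (m % 2 ^ j) + 1 := by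
    rw [pow_succ', Nat.mod_mul]
    have h : (2 * m + 1) / 2 = m := by omega
    rw [h]
    omega
  have hb : (2 * m + 1).testBit (j + 1) = m.testBit j := by
    rw [Nat.testBit_succ]
    congr 1
    omega
  unfold lam
  rw [hm, hb, pow_succ']
  split_ifs <;> omega

theorem lam_sub_lam_pred (k r i : ℕ) (hodd : Odd r) (hr0 : 0 < r) (hr : r < 2 ^ k)
    (hi0 : 0 < i) (hik : i < k) :
    (lam (2 ^ k + r) i : ℤ) - (lam (2 ^ k + r - 1) i : ℤ) =
      if (2 ^ k + r).testBit i then -1 else 1 := by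
  have hn : Odd (2 ^ k + r) :=
    (Nat.even_pow.mpr ⟨even_two, by omega⟩).add_odd hodd
  obtain ⟨m, hm⟩ := hn
  obtain ⟨j, rfl⟩ := Nat.exists_eq_succ_of_ne_zero hi0.ne'
  have hb : (2 * m + 1).testBit (j + 1) = m.testBit j := by
    rw [Nat.testBit_succ]
    congr 1
    omega
  rw [hm, Nat.add_sub_cancel, Nat.succ_eq_add_one, lam_two_mul_add_one_succ,
    lam_two_mul_succ, hb]
  push_cast
  ring
end

section
/- For all k ≥ 0 and all r with 0 ≤ r ≤ 2^k, δ(2^{k+1} − r) = δ(2^k + r). -/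
theorem delta_symm (k r : ℕ) (hr : r ≤ 2 ^ k) :
    delta (2 ^ (k + 1) - r) = delta (2 ^ k + r) := by
  induction k generalizing r with
  | zero =>
    have h : r = 0 ∨ r = 1 := by simp at hr; omega
    rcases h with rfl | rfl <;> simp [delta]
  | succ k ih =>
    have hk : 1 ≤ 2 ^ k := Nat.one_le_two_pow
    have h1 : 2 ^ (k + 1) = 2 * 2 ^ k := pow_succ' 2 k
    have h2 : 2 ^ (k + 1 + 1) = 2 * 2 ^ (k + 1) := pow_succ' 2 (k + 1)
    obtain ⟨s, rfl | rfl⟩ := r.even_or_odd'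
    · rw [show 2 ^ (k + 1 + 1) - 2 * s = 2 * (2 ^ (k + 1) - s) by omega,
        show 2 ^ (k + 1) + 2 * s = 2 * (2 ^ k + s) by omega,
        delta_two_mul, delta_two_mul, ih s (by omega)]
    · rw [show 2 ^ (k + 1 + 1) - (2 * s + 1) = 2 * (2 ^ (k + 1) - (s + 1)) + 1 by omega,
        show 2 ^ (k + 1) + (2 * s + 1) = 2 * (2 ^ k + s) + 1 by omega,
        delta_two_mul_add_one (by omega), delta_two_mul_add_one (by omega),
        show 2 ^ (k + 1) - (s + 1) + 1 = 2 ^ (k + 1) - s by omega,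
        ih s (by omega), ih (s + 1) (by omega), ← add_assoc (2 ^ k) s 1,
        add_comm (delta (2 ^ k + s + 1))]
end

section
/- Let k ≥ 1 and let r be an integer with 1 ≤ r ≤ 2^k − 1, and let ρ₁ be the 2-adic valuation of r (the position of the least significant nonzero bit of r). Then τ(r/2^k) = (1/2)·[τ((r−1)/2^k) + τ((r+1)/2^k)] + (1 − ρ₁)/2^k. -/
/-- The Takagi function `τ(x) = ∑_{i=0}^∞ dist(2^i·x, ℤ) / 2^i`, where the distance from
`y` to the nearest integer is `|y - round y|`. -/
noncomputable def takagi (x : ℝ) : ℝ := ∑' i : ℕ, |2 ^ i * x - round (2 ^ i * x)| / 2 ^ i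

theorem abs_sub_round_eq_of_abs_sub_le {x : ℝ} {n : ℤ} (h : |x - n| ≤ 1 / 2) :
    |x - round x| = |x - n| := by
  refine le_antisymm (round_le x n) ?_
  by_cases hn : round x = n
  · rw [hn]
  · have h1 : (1 : ℝ) ≤ |((round x - n : ℤ) : ℝ)| := by
      exact_mod_cast Int.one_le_abs (sub_ne_zero.mpr hn)
    have h2 : |((round x - n : ℤ) : ℝ)| ≤ |x - n| + |x - round x| := by
      have h3 := abs_sub (x - n) (x - round x)
      push_cast
      rwa [show x - n - (x - round x) = (round x : ℝ) - n by ring] at h3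
    linarith

theorem summable_takagi (x : ℝ) :
    Summable fun i : ℕ => |2 ^ i * x - round (2 ^ i * x)| / 2 ^ i := by
  refine Summable.of_nonneg_of_le (fun i => by positivity) (fun i => ?_)
    (summable_geometric_two.mul_left (1 / 2))
  rw [one_div_pow, div_eq_mul_one_div]
  gcongr
  exact abs_sub_round _

theorem takagi_eq_add_half (x : ℝ) : takagi x = |x - round x| + takagi (2 * x) / 2 := by
  unfold takagi
  rw [(summable_takagi x).tsum_eq_zero_add, ← tsum_div_const]
  congr 1
  · simp
  · refine tsum_congr fun i => ?_
    rw [show (2 : ℝ) ^ (i + 1) * x = 2 ^ i * (2 * x) by ring, div_div, pow_succ]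

theorem takagi_intCast (n : ℤ) : takagi n = 0 := by
  unfold takagi
  refine (tsum_congr fun i => ?_).trans tsum_zero
  rw [show (2 : ℝ) ^ i * n = ((2 ^ i * n : ℤ) : ℝ) by push_cast; rfl, round_intCast]
  simp

/-- On the piece `[n - 1/2, n + 1/2]`, written with denominator `2 * N`. -/
theorem abs_sub_round_div {N y : ℝ} (hN : 0 < N) (n : ℤ) (h : |y - 2 * N * n| ≤ N) :
    |y / (2 * N) - round (y / (2 * N))| = |y - 2 * N * n| / (2 * N) := by
  have h1 : |y / (2 * N) - n| = |y - 2 * N * n| / (2 * N) := by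
    rw [← abs_of_pos (show 0 < 2 * N by positivity), ← abs_div,
      abs_of_pos (show 0 < 2 * N by positivity)]
    congr 1
    field_simp
  rw [← h1]
  apply abs_sub_round_eq_of_abs_sub_le
  rw [h1, div_le_iff₀ (by positivity)]
  linarith

/-- The second difference, with step `1 / (2 * N)`, of the distance to the nearest integer. -/
theorem abs_sub_round_second_difference (N r : ℕ) (hN : 0 < N) :
    |(r : ℝ) / (2 * N) - round ((r : ℝ) / (2 * N))| -
      (|((r : ℝ) - 1) / (2 * N) - round (((r : ℝ) - 1) / (2 * N))| +
        |((r : ℝ) + 1) / (2 * N) - round (((r : ℝ) + 1) / (2 * N))|) / 2 =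
      if 2 * N ∣ r then -1 / (2 * N : ℝ) else if N ∣ r then 1 / (2 * N : ℝ) else 0 := by
  obtain ⟨q, s, hs, rfl⟩ : ∃ q s, s < 2 * N ∧ r = 2 * N * q + s :=
    ⟨r / (2 * N), r % (2 * N), Nat.mod_lt _ (by omega), (Nat.div_add_mod _ _).symm⟩
  have hNR : (0 : ℝ) < N := by exact_mod_cast hN
  have hN1 : (1 : ℝ) ≤ N := by exact_mod_cast hN
  have d1 : 2 * N ∣ 2 * N * q + s ↔ s = 0 := by
    rw [Nat.dvd_add_right (dvd_mul_right _ _)]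
    exact ⟨fun h => Nat.eq_zero_of_dvd_of_lt h hs, fun h => h ▸ dvd_zero _⟩
  have d2 : N ∣ 2 * N * q + s ↔ N ∣ s :=
    Nat.dvd_add_right (Dvd.intro_left 2 rfl |>.mul_right q)
  have left : ∀ e : ℝ, |(s : ℝ) + e| ≤ N →
      |(((2 * N * q + s : ℕ) : ℝ) + e) / (2 * N) -
        round ((((2 * N * q + s : ℕ) : ℝ) + e) / (2 * N))| = |(s : ℝ) + e| / (2 * N) := by
    intro e he
    have h : ((2 * N * q + s : ℕ) : ℝ) + e - 2 * N * ((q : ℤ) : ℝ) = s + e := by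
      push_cast; ring
    rw [abs_sub_round_div hNR q (by rwa [h]), h]
  have right : ∀ e : ℝ, |(s : ℝ) + e - 2 * N| ≤ N →
      |(((2 * N * q + s : ℕ) : ℝ) + e) / (2 * N) -
        round ((((2 * N * q + s : ℕ) : ℝ) + e) / (2 * N))| = |(s : ℝ) + e - 2 * N| / (2 * N) := by
    intro e he
    have h : ((2 * N * q + s : ℕ) : ℝ) + e - 2 * N * ((q + 1 : ℤ) : ℝ) = s + e - 2 * N := by
      push_cast; ring
    have h' := abs_sub_round_div hNR (q + 1) (y := ((2 * N * q + s : ℕ) : ℝ) + e) (by rwa [h])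
    rw [h', h]
  have left₀ := left 0
  have right₀ := right 0
  simp only [add_zero] at left₀ right₀
  simp only [d1, d2, sub_eq_add_neg _ (1 : ℝ)]
  obtain rfl | hs0 := Nat.eq_zero_or_pos s
  · rw [left₀ (by simp), left (-1) (by simpa using hN1), left 1 (by simpa using hN1)]
    simp
    field_simp
  have hs0R : (1 : ℝ) ≤ s := by exact_mod_cast hs0
  have hsR : (s : ℝ) + 1 ≤ 2 * N := by exact_mod_cast hs
  rcases lt_trichotomy s N with h | rfl | h
  · have hR : (s : ℝ) + 1 ≤ N := by exact_mod_cast h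
    have hnd : ¬ N ∣ s := Nat.not_dvd_of_pos_of_lt hs0 h
    rw [left₀ (by rw [abs_le]; constructor <;> linarith),
      left (-1) (by rw [abs_le]; constructor <;> linarith),
      left 1 (by rw [abs_le]; constructor <;> linarith), if_neg hs0.ne', if_neg hnd,
      abs_of_nonneg (by linarith), abs_of_nonneg (by linarith), abs_of_nonneg (by linarith)]
    ring
  · rw [left₀ (by rw [abs_le]; constructor <;> linarith),
      left (-1) (by rw [abs_le]; constructor <;> linarith),
      right 1 (by rw [abs_le]; constructor <;> linarith), if_neg hs0.ne', if_pos dvd_rfl,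
      abs_of_nonneg (by linarith), abs_of_nonneg (by linarith), abs_of_nonpos (by linarith)]
    field_simp
    ring
  · have hR : (N : ℝ) + 1 ≤ s := by exact_mod_cast h
    have hnd : ¬ N ∣ s := by
      rintro ⟨c, rfl⟩
      have h1 : 1 < c := lt_of_mul_lt_mul_left (by omega : N * 1 < N * c) (Nat.zero_le N)
      have h2 : c < 2 := lt_of_mul_lt_mul_left (by omega : N * c < N * 2) (Nat.zero_le N)
      omega
    rw [right₀ (by rw [abs_le]; constructor <;> linarith),
      right (-1) (by rw [abs_le]; constructor <;> linarith),
      right 1 (by rw [abs_le]; constructor <;> linarith), if_neg hs0.ne', if_neg hnd,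
      abs_of_nonpos (by linarith), abs_of_nonpos (by linarith), abs_of_nonpos (by linarith)]
    ring

theorem takagi_second_difference (k r : ℕ) (hr : r ≠ 0) :
    takagi ((r : ℝ) / 2 ^ k) -
      (takagi (((r : ℝ) - 1) / 2 ^ k) + takagi (((r : ℝ) + 1) / 2 ^ k)) / 2 =
      if 2 ^ k ∣ r then -(k : ℝ) / 2 ^ k else (1 - (padicValNat 2 r : ℝ)) / 2 ^ k := by
  induction k with
  | zero =>
    have h1 := takagi_intCast r
    have h2 := takagi_intCast (r - 1)
    have h3 := takagi_intCast (r + 1)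
    push_cast at h1 h2 h3
    simp [h1, h2, h3]
  | succ k ih =>
    have step : ∀ y : ℝ, takagi (y / 2 ^ (k + 1)) =
        |y / (2 * (2 ^ k : ℕ)) - round (y / (2 * (2 ^ k : ℕ)))| + takagi (y / 2 ^ k) / 2 := by
      intro y
      have h1 : y / (2 * (2 ^ k : ℕ)) = y / 2 ^ (k + 1) := by push_cast; rw [pow_succ']
      have h2 : 2 * (y / 2 ^ (k + 1)) = y / 2 ^ k := by rw [pow_succ]; field_simp
      rw [takagi_eq_add_half, h1, h2]
    have hd := abs_sub_round_second_difference (2 ^ k) r (by positivity)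
    rw [step, step, step]
    have key : ∀ a b c A B C : ℝ, a + A / 2 - (b + B / 2 + (c + C / 2)) / 2 =
        (a - (b + c) / 2) + (A - (B + C) / 2) / 2 := by intros; ring
    rw [key, hd, ih, ← pow_succ']
    by_cases h1 : 2 ^ (k + 1) ∣ r
    · have h2 : 2 ^ k ∣ r := (pow_dvd_pow 2 k.le_succ).trans h1
      simp only [h1, h2, if_true]
      push_cast
      field_simp
      ring
    · by_cases h2 : 2 ^ k ∣ r
      · have hv : padicValNat 2 r = k := by
          have a := (padicValNat_dvd_iff_le (p := 2) hr).mp h2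
          have b := mt (padicValNat_dvd_iff_le (p := 2) hr).mpr h1
          omega
        simp only [h1, h2, if_true, if_false, hv]
        push_cast
        field_simp
        ring
      · simp only [h1, h2, if_false]
        field_simp
        ring

theorem takagi_midpoint (k r : ℕ) (hk : 1 ≤ k) (hr0 : 1 ≤ r) (hr : r ≤ 2 ^ k - 1) :
    takagi ((r : ℝ) / 2 ^ k) =
      (1 / 2) * (takagi (((r : ℝ) - 1) / 2 ^ k) + takagi (((r : ℝ) + 1) / 2 ^ k)) +
        (1 - (padicValNat 2 r : ℝ)) / 2 ^ k := by
  have hnd : ¬ 2 ^ k ∣ r := fun h => by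
    have := Nat.le_of_dvd hr0 h
    omega
  have h := takagi_second_difference k r (by omega)
  rw [if_neg hnd] at h
  linarith
end

section
/- Let k ≥ 0, let r be an integer with 0 ≤ r < 2^k, and set n = 2^k + r. Then τ((r+1)/2^k) = τ(r/2^k) + (1/2^k)·(k − 2·s₁(n) + 2). -/
/-- Hamming weight of `n`: number of 1s in the binary expansion of `n`. -/
def s1 (n : ℕ) : ℕ := (Nat.digits 2 n).sum

theorem takagi_add_one (x : ℝ) : takagi (x + 1) = takagi x := by
  unfold takagi
  refine tsum_congr fun i => ?_
  have h : (2 : ℝ) ^ i * (x + 1) = 2 ^ i * x + ((2 ^ i : ℕ) : ℝ) := by push_cast; ring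
  rw [h, round_add_natCast]
  push_cast
  congr 2
  ring

theorem abs_sub_round_eq_min_of_mem_Icc {x : ℝ} (h0 : 0 ≤ x) (h1 : x ≤ 1) :
    |x - round x| = min x (1 - x) := by
  rcases h1.eq_or_lt with rfl | h1
  · simp
  · rw [abs_sub_round_eq_min, Int.fract_eq_self.2 ⟨h0, h1⟩]

theorem s1_eq_mod_add_s1_div (n : ℕ) : s1 n = n % 2 + s1 (n / 2) := by
  rcases Nat.eq_zero_or_pos n with rfl | h
  · simp [s1]
  · unfold s1
    rw [Nat.digits_def' one_lt_two h, List.sum_cons]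

theorem s1_two_pow_add (k r : ℕ) (hr : r < 2 ^ k) : s1 (2 ^ k + r) = s1 r + 1 := by
  induction k generalizing r with
  | zero =>
    obtain rfl : r = 0 := by simpa using hr
    simp [s1]
  | succ k ih =>
    rw [pow_succ] at *
    rw [s1_eq_mod_add_s1_div, s1_eq_mod_add_s1_div r,
      show (2 ^ k * 2 + r) % 2 = r % 2 by omega,
      show (2 ^ k * 2 + r) / 2 = 2 ^ k + r / 2 by omega, ih (r / 2) (by omega)]
    ring

theorem takagi_succ (k r : ℕ) (hr : r < 2 ^ k) :
    takagi (((r : ℝ) + 1) / 2 ^ k) =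
      takagi ((r : ℝ) / 2 ^ k) +
        (1 / 2 ^ k) * ((k : ℝ) - 2 * (s1 (2 ^ k + r) : ℝ) + 2) := by
  induction k generalizing r with
  | zero =>
    obtain rfl : r = 0 := by simpa using hr
    simpa [s1] using takagi_add_one 0
  | succ k ih =>
    have hk : (0 : ℝ) < 2 ^ k := by positivity
    have double (y : ℝ) : 2 * (y / 2 ^ (k + 1)) = y / 2 ^ k := by rw [pow_succ]; field_simp
    have hr' : (r : ℝ) + 1 ≤ 2 ^ (k + 1) := by exact_mod_cast hr
    have hr0 : (0 : ℝ) ≤ r := Nat.cast_nonneg r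
    rw [takagi_eq_add_half (((r : ℝ) + 1) / 2 ^ (k + 1)), takagi_eq_add_half ((r : ℝ) / 2 ^ (k + 1)),
      double, double,
      abs_sub_round_eq_min_of_mem_Icc (by positivity) ((div_le_one (by positivity)).2 hr'),
      abs_sub_round_eq_min_of_mem_Icc (by positivity)
        ((div_le_one (by positivity)).2 (by linarith)),
      s1_two_pow_add _ _ hr]
    rw [pow_succ] at *
    rcases lt_or_ge r (2 ^ k) with h | h
    · have h' : (r : ℝ) + 1 ≤ 2 ^ k := by exact_mod_cast h
      rw [min_eq_left, min_eq_left, ih r h, s1_two_pow_add _ _ h]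
      · push_cast
        field_simp
        ring
      · field_simp
        linarith
      · field_simp
        linarith
    · obtain ⟨q, rfl⟩ := Nat.exists_eq_add_of_le h
      have hq : q < 2 ^ k := by omega
      have hq0 : (0 : ℝ) ≤ q := Nat.cast_nonneg q
      have shift (y : ℝ) : takagi ((2 ^ k + y) / 2 ^ k) = takagi (y / 2 ^ k) := by
        rw [← takagi_add_one (y / 2 ^ k)]
        congr 1
        field_simp
        ring
      push_cast
      rw [add_assoc ((2 : ℝ) ^ k), shift, shift, min_eq_right, min_eq_right, ih q hq,
        s1_two_pow_add _ _ hq]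
      · push_cast
        field_simp
        ring
      · field_simp
        linarith
      · field_simp
        linarith
end
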